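/- arXiv:0712.2104 — 2 statements merged into one kernel-verified Lean document; each statement's English description precedes it below -/
import Mathlib

section
/- Let T be a finite abelian group and π : F → T a surjection from a finitely generated free abelian group F whose rank is strictly greater than the minimal number of generators of T. Then every automorphism h of T lifts to an automorphism f of F, i.e. there exists f ∈ Aut(F) with π ∘ f = h ∘ π. -/
/-- `x` is the tuple of images of some basis of `ℤⁿ` under `φ`. -/
def TupOf {n : ℕ} {T : Type} [AddCommGroup T] (φ : (Fin n → ℤ) →ₗ[ℤ] T) (x : Fin n → T) : Prop :=
  ∃ b : Module.Basis (Fin n) ℤ (Fin n → ℤ), ∀ i, φ (b i) = x i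

theorem TupOf.step {n : ℕ} {T : Type} [AddCommGroup T] {φ : (Fin n → ℤ) →ₗ[ℤ] T} {x : Fin n → T}
    (hx : TupOf φ x) {i j : Fin n} (hij : i ≠ j) (c : ℤ) :
    TupOf φ (Function.update x i (x i + c • x j)) := by
  obtain ⟨b, hb⟩ := hx
  have h0 : (c • b.coord i) (b j) = 0 := by
    simp [hij.symm]
  refine ⟨b.map (LinearEquiv.transvection h0), fun k => ?_⟩
  rw [Module.Basis.map_apply, LinearEquiv.transvection.apply]
  by_cases hk : k = i
  · subst hk
    rw [map_add, map_smul, hb, hb]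
    simp
  · rw [map_add, map_smul, hb, hb]
    simp [hk]

theorem TupOf.add_span {n : ℕ} {T : Type} [AddCommGroup T] {φ : (Fin n → ℤ) →ₗ[ℤ] T}
    {x : Fin n → T} (hx : TupOf φ x) {i : Fin n} {w : T}
    (hw : w ∈ Submodule.span ℤ (x '' {i}ᶜ)) :
    TupOf φ (Function.update x i (x i + w)) := by
  have key : ∀ z, TupOf φ (Function.update x i z) →
      TupOf φ (Function.update x i (z + w)) := by
    induction hw using Submodule.span_induction with
    | mem w hw =>
      intro z hz
      obtain ⟨j, hj, rfl⟩ := hw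
      have hj' : j ≠ i := hj
      have := hz.step (i := i) (j := j) hj'.symm 1
      simpa [hj'] using this
    | zero => intro z hz; simpa using hz
    | add u v _ _ hu hv =>
      intro z hz
      rw [← add_assoc]
      exact hv _ (hu _ hz)
    | smul a u hu' hu =>
      clear hu
      intro z hz
      induction hu' using Submodule.span_induction generalizing z a with
      | mem w hw =>
        obtain ⟨j, hj, rfl⟩ := hw
        have hj' : j ≠ i := hj
        have := hz.step (i := i) (j := j) hj'.symm a
        simpa [hj'] using this
      | zero => simpa using hz
      | add u v _ _ hu hv =>
        rw [smul_add, ← add_assoc]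
        exact hv _ _ (hu _ _ hz)
      | smul a' u _ hu => rw [smul_smul]; exact hu _ _ hz
  exact key _ (by simpa using hx)

theorem TupOf.clear {n : ℕ} {T : Type} [AddCommGroup T] {φ : (Fin n → ℤ) →ₗ[ℤ] T}
    {x : Fin n → T} (hx : TupOf φ x) (p : Fin n) (c : Fin n → ℤ) (s : Finset (Fin n))
    (hs : p ∉ s) : TupOf φ (fun i => if i ∈ s then x i + c i • x p else x i) := by
  induction s using Finset.induction_on with
  | empty => simpa using hx
  | insert a s ha ih =>
    have hps : p ∉ s := fun h => hs (Finset.mem_insert_of_mem h)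
    have hap : a ≠ p := fun h => hs (h ▸ Finset.mem_insert_self _ _)
    have := (ih hps).step hap (c a)
    convert this using 1
    funext i
    by_cases hi : i = a
    · subst hi; simp [ha, hps]
    · simp [hi]

theorem TupOf.euclid {n : ℕ} {T : Type} [AddCommGroup T] {φ : (Fin n → ℤ) →ₗ[ℤ] T} (t : T)
    (m : ℕ) : ∀ (x : Fin n → T) (_ : TupOf φ x) (i j : Fin n) (_ : i ≠ j) (a b : ℤ)
    (_ : b.natAbs = m) (_ : x i = a • t) (_ : x j = b • t),
    ∃ y, TupOf φ y ∧ (∀ k, k ≠ i → k ≠ j → y k = x k) ∧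
      ∃ c : ℤ, (y i = c • t ∧ y j = 0) ∨ (y j = c • t ∧ y i = 0) := by
  induction m using Nat.strong_induction_on with
  | _ m ih =>
    intro x hx i j hij a b hb hi hj
    by_cases hb0 : b = 0
    · exact ⟨x, hx, fun _ _ _ => rfl, a, Or.inl ⟨hi, by simp [hj, hb0]⟩⟩
    have hlt : (a % b).natAbs < m := by
      have h1 := Int.emod_nonneg a hb0
      have h2 := Int.emod_lt_abs a hb0
      rw [Int.abs_eq_natAbs] at h2
      omega
    obtain ⟨y, hy, hyk, c, hc⟩ := ih _ hlt _ (hx.step hij (-(a / b))) j i hij.symm b (a % b) rfl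
      (by simp [hij.symm, hj])
      (by
        simp only [Function.update_self, hi, hj, smul_smul, ← add_smul]
        congr 1
        have := Int.emod_add_mul_ediv a b
        linarith)
    refine ⟨y, hy, fun k hk hk' => ?_, c, hc.symm⟩
    rw [hyk k hk' hk]
    simp [hk]

theorem TupOf.span_eq {n : ℕ} {T : Type} [AddCommGroup T] {φ : (Fin n → ℤ) →ₗ[ℤ] T}
    (hφ : Function.Surjective φ) {x : Fin n → T} (hx : TupOf φ x) :
    Submodule.span ℤ (Set.range x) = ⊤ := by
  obtain ⟨b, hb⟩ := hx
  have : x = φ ∘ b := by funext i; simp [hb]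
  rw [this, Set.range_comp, Submodule.span_image, b.span_eq, Submodule.map_top,
    LinearMap.range_eq_top.2 hφ]

theorem TupOf.main {n : ℕ} (d : ℕ) : ∀ (_ : d < n) (T : Type) [AddCommGroup T]
    (φ : (Fin n → ℤ) →ₗ[ℤ] T) (_ : Function.Surjective φ) (g : Fin n → T)
    (_ : Submodule.span ℤ (Set.range g) = ⊤) (_ : ∀ i : Fin n, d ≤ i → g i = 0), TupOf φ g := by
  induction d with
  | zero =>
    intro _ T _ φ hφ g hg h0
    have hg0 : g = 0 := funext fun i => h0 i (Nat.zero_le _)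
    have hT : ∀ t : T, t = 0 := by
      intro t
      have : t ∈ Submodule.span ℤ (Set.range g) := hg ▸ Submodule.mem_top
      have h2 : Submodule.span ℤ (Set.range g) = ⊥ := by
        rw [Submodule.span_eq_bot]
        rintro _ ⟨i, rfl⟩
        simp [hg0]
      rw [h2] at this
      simpa using this
    exact ⟨Pi.basisFun ℤ _, fun i => by rw [hT (φ _), hT (g i)]⟩
  | succ d ih =>
    intro hd T _ φ hφ g hg h0
    let p : Fin n := ⟨d, by omega⟩
    let q : Fin n := ⟨d + 1, hd⟩
    have hpq : p ≠ q := by simp [p, q]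
    set t := g p with ht
    let N := Submodule.span ℤ {t}
    have hgq : g q = 0 := h0 q le_rfl
    obtain ⟨b, hb⟩ := ih (by omega) (T ⧸ N) (N.mkQ ∘ₗ φ)
      (N.mkQ_surjective.comp hφ) (N.mkQ ∘ g)
      (by rw [Set.range_comp, Submodule.span_image, hg, Submodule.map_top, Submodule.range_mkQ])
      (by
        intro i hi
        by_cases hip : i = p
        · subst hip
          simp only [Function.comp_apply, Submodule.mkQ_apply, Submodule.Quotient.mk_eq_zero]
          exact Submodule.mem_span_singleton_self _
        · have : d + 1 ≤ (i : ℕ) := by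
            have : (i : ℕ) ≠ d := fun h => hip (Fin.ext h)
            omega
          simp [h0 i this])
    have hb' : ∀ i, ∃ c : ℤ, φ (b i) = g i + c • t := by
      intro i
      have h1 := hb i
      simp only [LinearMap.comp_apply, Function.comp_apply, Submodule.mkQ_apply] at h1
      rw [Submodule.Quotient.eq] at h1
      obtain ⟨c, hc⟩ := Submodule.mem_span_singleton.1 h1
      exact ⟨c, by rw [hc]; abel⟩
    choose c hc using hb'
    have hx : TupOf φ (fun i => φ (b i)) := ⟨b, fun _ => rfl⟩
    obtain ⟨y, hy, hyk, e, he⟩ := TupOf.euclid t _ _ hx p q hpq (1 + c p) (c q) rfl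
      (by simp only [hc, add_smul, one_smul, ht]) (by simp only [hc, hgq, zero_add])
    -- a common form of the two alternatives
    have hr : ∃ r : Fin n, (r = p ∨ r = q) ∧ y r = 0 ∧ ∃ c' : Fin n → ℤ,
        ∀ i, i ≠ r → y i + c' i • t = g i := by
      rcases he with ⟨h1, h2⟩ | ⟨h1, h2⟩
      · refine ⟨q, Or.inr rfl, h2, fun i => if i = p then 1 - e else - c i, fun i hi => ?_⟩
        by_cases hip : i = p
        · subst hip
          simp only [if_true, h1, ← add_smul, ← ht]
          simp
        · simp only [hip, if_false]
          rw [hyk i hip hi]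
          simp only [hc, neg_smul]; abel
      · refine ⟨p, Or.inl rfl, h2, fun i => if i = q then - e else - c i, fun i hi => ?_⟩
        by_cases hip : i = q
        · subst hip
          simp [h1, hgq]
        · simp only [hip, if_false]
          rw [hyk i hi hip]
          simp only [hc, neg_smul]; abel
    obtain ⟨r, hr, hyr, c', hc'⟩ := hr
    have hmem : t ∈ Submodule.span ℤ (y '' {r}ᶜ) := by
      have h1 : t ∈ Submodule.span ℤ (Set.range y) := by
        rw [hy.span_eq hφ]; exact Submodule.mem_top
      refine Submodule.span_le.2 ?_ h1
      rintro _ ⟨i, rfl⟩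
      by_cases hi : i = r
      · subst hi; rw [hyr]; exact Submodule.zero_mem _
      · exact Submodule.subset_span ⟨i, hi, rfl⟩
    have h1 := hy.add_span hmem
    rw [hyr, zero_add] at h1
    have h2 := h1.clear r c' (Finset.univ.erase r) (by simp)
    have h3 : TupOf φ (Function.update g r t) := by
      convert h2 using 1
      funext i
      by_cases hi : i = r
      · subst hi; simp
      · simp [hi, hc' i hi]
    rcases hr with rfl | rfl
    · simpa [ht] using h3
    · have h4 := h3.step hpq.symm (-1)
      have : g = Function.update g q 0 := by rw [← hgq]; simp
      rw [this]
      simpa [hpq, ← ht] using h4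

/-- Let `T` be a finite abelian group and `π : F → T` a surjection from the
free abelian group `F = Fin n → ℤ` whose rank `n` is strictly greater than the minimal number of
generators of `T` (expressed by the existence of a generating set of cardinality `< n`).  Then
every automorphism `h` of `T` lifts to an automorphism `f` of `F`, i.e. `π ∘ f = h ∘ π`. -/
theorem stmt_4 (n : ℕ) (T : Type) [AddCommGroup T] [Fintype T]
    (π : (Fin n → ℤ) →+ T) (hπ : Function.Surjective π)
    (hnonmin : ∃ s : Finset T, Submodule.span ℤ (s : Set T) = ⊤ ∧ s.card < n)
    (h : T ≃+ T) :
    ∃ f : (Fin n → ℤ) ≃ₗ[ℤ] (Fin n → ℤ), ∀ v, π (f v) = h (π v) := by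
  obtain ⟨s, hs, hcard⟩ := hnonmin
  let g : Fin n → T := fun i =>
    if hi : (i : ℕ) < s.card then (s.equivFin.symm ⟨i, hi⟩ : T) else 0
  have hg : Submodule.span ℤ (Set.range g) = ⊤ := by
    rw [eq_top_iff, ← hs]
    apply Submodule.span_mono
    intro t ht
    have hlt := (s.equivFin ⟨t, ht⟩).2
    refine ⟨⟨s.equivFin ⟨t, ht⟩, by omega⟩, ?_⟩
    simp [g]
  have hg0 : ∀ i : Fin n, s.card ≤ i → g i = 0 := by
    intro i hi
    simp [g, not_lt.2 hi]
  obtain ⟨b₁, hb₁⟩ := TupOf.main s.card hcard T π.toIntLinearMap hπ g hg hg0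
  obtain ⟨b₂, hb₂⟩ := TupOf.main s.card hcard T (h.toAddMonoidHom.comp π).toIntLinearMap
    (h.surjective.comp hπ) g hg hg0
  refine ⟨b₂.equiv b₁ (Equiv.refl _), fun v => ?_⟩
  have : π.toIntLinearMap ∘ₗ (b₂.equiv b₁ (Equiv.refl _)).toLinearMap
      = (h.toAddMonoidHom.comp π).toIntLinearMap := by
    refine b₂.ext fun i => ?_
    rw [hb₂, ← hb₁]
    simp
  exact LinearMap.congr_fun this v
end

section
/- Let H be a finite abelian group of rank r with smallest elementary divisor τ, and let π : F → H be a surjection from a free abelian group F of rank exactly r. Let h : H → H be an automorphism whose induced map on Λ^r H (which is cyclic of order τ) is multiplication by ±1. Then h lifts to an automorphism f of F, i.e. π ∘ f = h ∘ π with f ∈ Aut(F). -/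
open Module

/-- A functional taking the value one splits off a basis vector. -/
theorem aux_split {n : ℕ} {M : Type*} [AddCommGroup M] (b0 : Basis (Fin (n+1)) ℤ M)
    (ψ : M →ₗ[ℤ] ℤ) (y : M) (hy : ψ y = 1) :
    Nonempty (Basis (Fin n) ℤ (LinearMap.ker ψ)) ∧
    ∀ b' : Basis (Fin n) ℤ (LinearMap.ker ψ), ∃ b : Basis (Fin (n+1)) ℤ M,
      b 0 = y ∧ ∀ i : Fin n, b i.succ = (b' i : M) := by
  have hmk : ∀ {m : ℕ} (b' : Basis (Fin m) ℤ (LinearMap.ker ψ)),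
      ∃ b : Basis (Fin (m+1)) ℤ M, b 0 = y ∧ ∀ i : Fin m, b i.succ = (b' i : M) := by
    intro m b'
    refine ⟨Basis.mkFinCons y b' ?_ ?_, ?_, ?_⟩
    · intro c x hx hc
      have := congrArg ψ hc
      simpa [hy, LinearMap.mem_ker.mp hx] using this
    · intro z
      exact ⟨-ψ z, by simp [LinearMap.mem_ker, hy]⟩
    · simp
    · simp
  refine ⟨?_, fun b' => hmk b'⟩
  obtain ⟨m, ⟨b'⟩⟩ := Submodule.nonempty_basis_of_pid b0 (LinearMap.ker ψ)
  obtain ⟨b, -⟩ := hmk b'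
  have e := Fintype.card_congr (b.indexEquiv b0)
  simp at e
  subst e
  exact ⟨b'⟩

/-- Smith normal form with divisibility chain. -/
theorem aux_smith (n : ℕ) : ∀ (M : Type) [AddCommGroup M] (_ : Basis (Fin n) ℤ M)
    (K : Submodule ℤ M), ∃ (b : Basis (Fin n) ℤ M) (d : Fin n → ℤ),
      (∀ i j, i ≤ j → d i ∣ d j) ∧ ∀ v, v ∈ K ↔ ∀ i, d i ∣ b.repr v i := by
  induction n with
  | zero =>
    intro M _ b0 K
    refine ⟨b0, fun _ => 0, fun i => i.elim0, fun v => ?_⟩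
    have : v = 0 := b0.repr.injective (by ext i; exact i.elim0)
    subst this
    simp
  | succ n ih =>
    intro M _ b0 K
    by_cases hK : ∃ m : ℕ, m ≠ 0 ∧ ∃ (ψ : M →ₗ[ℤ] ℤ), ∃ k ∈ K, (ψ k).natAbs = m
    swap
    · push Not at hK
      refine ⟨b0, fun _ => 0, fun i j _ => dvd_rfl, fun v => ?_⟩
      constructor
      · intro hv i
        by_contra hne
        have h0 : b0.repr v i ≠ 0 := fun h => hne (by simp [h])
        exact hK _ (Int.natAbs_ne_zero.mpr h0) (b0.coord i) v hv rfl
      · intro hv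
        have : v = 0 := b0.repr.injective (by ext i; simpa using hv i)
        subst this
        exact K.zero_mem
    · classical
      obtain ⟨hm0, ψ0, k0, hk0, hmk⟩ := Nat.find_spec hK
      have hmin : ∀ (ψ : M →ₗ[ℤ] ℤ) (k), k ∈ K → (ψ k).natAbs < (ψ0 k0).natAbs → ψ k = 0 := by
        intro ψ k hk hlt
        by_contra hne
        rw [hmk] at hlt
        exact Nat.find_min hK hlt ⟨Int.natAbs_ne_zero.mpr hne, ψ, k, hk, rfl⟩
      set a := ψ0 k0 with ha
      have ha0 : a ≠ 0 := by
        intro h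
        rw [h] at hmk
        exact hm0 hmk.symm
      have hlt : ∀ z : ℤ, (z % a).natAbs < a.natAbs := by
        intro z
        have h1 := Int.emod_nonneg z ha0
        have h2 := Int.emod_lt_abs z ha0
        rw [Int.abs_eq_natAbs] at h2
        zify
        rw [abs_of_nonneg h1, ← Int.natCast_natAbs]
        exact h2
      -- every functional on k0
      have h1 : ∀ ψ : M →ₗ[ℤ] ℤ, a ∣ ψ k0 := by
        intro ψ
        have e : (ψ - (ψ k0 / a) • ψ0) k0 = ψ k0 % a := by
          simp only [LinearMap.sub_apply, LinearMap.smul_apply, smul_eq_mul, ← ha]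
          rw [Int.emod_def]; ring
        have := hmin (ψ - (ψ k0 / a) • ψ0) k0 hk0 (by rw [e]; exact hlt _)
        rw [e] at this
        exact Int.dvd_of_emod_eq_zero this
      have h2 : ∀ ψ : M →ₗ[ℤ] ℤ, ψ k0 = a → ∀ k ∈ K, a ∣ ψ k := by
        intro ψ hψ k hk
        have e : ψ (k - (ψ k / a) • k0) = ψ k % a := by
          simp only [map_sub, map_smul, smul_eq_mul, hψ]
          rw [Int.emod_def]; ring
        have := hmin ψ _ (K.sub_mem hk (K.smul_mem (ψ k / a) hk0)) (by rw [e]; exact hlt _)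
        rw [e] at this
        exact Int.dvd_of_emod_eq_zero this
      have h3 : ∀ ψ : M →ₗ[ℤ] ℤ, ∀ k ∈ K, a ∣ ψ k := by
        intro ψ k hk
        obtain ⟨c, hc⟩ := h1 ψ
        have h4 := h2 (ψ0 + (ψ - c • ψ0)) (by simp [hc, ← ha, mul_comm]) k hk
        have h5 := h2 ψ0 rfl k hk
        have : ψ k = (ψ0 + (ψ - c • ψ0)) k + (c - 1) * ψ0 k := by simp; ring
        rw [this]
        exact dvd_add h4 (h5.mul_left _)
      choose c hc using fun i => h1 (b0.coord i)
      let y : M := ∑ i, c i • b0 i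
      have hay : a • y = k0 := by
        rw [← b0.sum_repr k0, Finset.smul_sum]
        refine Finset.sum_congr rfl fun i _ => ?_
        rw [← mul_smul, ← hc]; rfl
      have hy : ψ0 y = 1 := by
        have : a * ψ0 y = a * 1 := by rw [← smul_eq_mul, ← map_smul, hay, mul_one]
        exact mul_left_cancel₀ ha0 this
      obtain ⟨⟨b1⟩, hext⟩ := aux_split b0 ψ0 y hy
      obtain ⟨b', d', hd', hb'⟩ := ih (LinearMap.ker ψ0) b1 (K.comap (LinearMap.ker ψ0).subtype)
      obtain ⟨b, hb0, hbs⟩ := hext b'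
      have hdec : ∀ v : M, ∃ u : LinearMap.ker ψ0, v = ψ0 v • y + (u : M) := by
        intro v
        exact ⟨⟨v - ψ0 v • y, by simp [LinearMap.mem_ker, hy]⟩, by simp⟩
      have hrepr : ∀ (t : ℤ) (u : LinearMap.ker ψ0),
          b.repr (t • y + (u : M)) = Finsupp.cons t (b'.repr u) := by
        intro t u
        have : t • y + (u : M) = b.repr.symm (Finsupp.cons t (b'.repr u)) := by
          rw [Basis.repr_symm_apply, Finsupp.linearCombination_apply, Finsupp.sum_fintype _ _ (by simp),
            Fin.sum_univ_succ]
          simp only [Finsupp.cons_zero, Finsupp.cons_succ, hb0, hbs]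
          congr 1
          have := congrArg Subtype.val (b'.sum_repr u)
          simp only [Submodule.coe_sum, Submodule.coe_smul] at this
          exact this.symm
        rw [this, LinearEquiv.apply_symm_apply]
      refine ⟨b, Fin.cons a d', ?_, ?_⟩
      · have had : ∀ i, a ∣ d' i := by
          intro i
          have hm : d' i • b' i ∈ K.comap (LinearMap.ker ψ0).subtype := by
            rw [hb']
            intro j
            by_cases hij : i = j
            · subst hij; simp
            · simp [hij]
          have := h3 (b.coord i.succ) _ hm
          simpa [← hbs] using this
        intro i j hij
        induction i using Fin.cases with
        | zero =>
          induction j using Fin.cases with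
          | zero => exact dvd_rfl
          | succ j => simpa using had j
        | succ i =>
          induction j using Fin.cases with
          | zero => simp at hij
          | succ j => simpa using hd' i j (by simpa using hij)
      · intro v
        obtain ⟨u, hu⟩ := hdec v
        have hr := hrepr (ψ0 v) u
        rw [← hu] at hr
        rw [hr, Fin.forall_fin_succ]
        simp only [Fin.cons_zero, Fin.cons_succ, Finsupp.cons_zero, Finsupp.cons_succ]
        have hbu := hb' u
        rw [← hbu]
        simp only [Submodule.mem_comap, Submodule.subtype_apply]
        have hyK : a ∣ ψ0 v → ψ0 v • y ∈ K := by
          rintro ⟨q, hq⟩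
          rw [hq, mul_comm, mul_smul, hay]
          exact K.smul_mem _ hk0
        constructor
        · intro hv
          have h5 := h2 ψ0 rfl v hv
          refine ⟨h5, ?_⟩
          rw [hu] at hv
          exact (K.add_mem_iff_right (hyK h5)).mp hv
        · rintro ⟨h5, h6⟩
          rw [hu]
          exact K.add_mem (hyK h5) h6

theorem aux_content {n : ℕ} {M : Type*} [AddCommGroup M] (B : Basis (Fin (n+1)) ℤ M)
    (a : M →ₗ[ℤ] ℤ) : ∃ (g : ℤ) (b : M →ₗ[ℤ] ℤ) (u : M), a = g • b ∧ b u = 1 := by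
  by_cases h0 : a = 0
  · exact ⟨0, B.coord 0, B 0, by simp [h0], by simp⟩
  let g := Submodule.IsPrincipal.generator (LinearMap.range a)
  have hg : ∀ v, g ∣ a v := fun v =>
    (Submodule.IsPrincipal.mem_iff_generator_dvd (LinearMap.range a)).mp ⟨v, rfl⟩
  have hg0 : g ≠ 0 := by
    intro h
    apply h0
    ext v
    have := hg v
    rw [h] at this
    simpa using this
  obtain ⟨u, hu⟩ : g ∈ LinearMap.range a := Submodule.IsPrincipal.generator_mem _
  choose c hc using fun v => hg v
  refine ⟨g, B.constr ℤ (fun i => c (B i)), u, ?_, ?_⟩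
  · refine B.ext fun i => ?_
    simp [hc (B i)]
  · have : a = g • B.constr ℤ (fun i => c (B i)) := by
      refine B.ext fun i => ?_
      simp [hc (B i)]
    have h2 := hu
    rw [this] at h2
    simp only [LinearMap.smul_apply, smul_eq_mul] at h2
    exact mul_left_cancel₀ hg0 (by rw [h2, mul_one])

theorem aux_modif {n : ℕ} {M : Type*} [AddCommGroup M] (B0 : Basis (Fin (n+2)) ℤ M)
    (a : M →ₗ[ℤ] ℤ) (d : ℤ) (x : M) (y : ℤ) (hxy : a x + d * y = 1) :
    ∃ (w : M →ₗ[ℤ] ℤ) (x' : M), (a + d • w) x' = 1 := by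
  obtain ⟨g, b, u, rfl, hu⟩ := aux_content B0 a
  obtain ⟨⟨b'⟩, hext⟩ := aux_split B0 b u hu
  obtain ⟨B, h0, hs⟩ := hext b'
  have h1 : b (B 1) = 0 := by
    have := hs 0
    rw [show (Fin.succ 0 : Fin (n+2)) = 1 from rfl] at this
    rw [this]
    exact (b' 0).2
  refine ⟨B.coord 1, b x • B 0 + y • B 1, ?_⟩
  have h2 : b (B 0) = 1 := by rw [h0, hu]
  simp [h1, h2] at hxy ⊢
  exact hxy

open Matrix in
theorem aux_row {n : ℕ} (a x : Fin (n+1) → ℤ) (h : a ⬝ᵥ x = 1) :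
    ∃ V : Matrix (Fin (n+1)) (Fin (n+1)) ℤ, IsUnit V.det ∧ a ᵥ* V = Pi.single 0 1 := by
  let ψ : (Fin (n+1) → ℤ) →ₗ[ℤ] ℤ := dotProductBilin ℤ ℤ a
  have hψ : ∀ v, ψ v = a ⬝ᵥ v := fun v => rfl
  obtain ⟨⟨b'⟩, hext⟩ := aux_split (Pi.basisFun ℤ (Fin (n+1))) ψ x h
  obtain ⟨B, h0, hs⟩ := hext b'
  refine ⟨(Pi.basisFun ℤ (Fin (n+1))).toMatrix B, ?_, ?_⟩
  · rw [← Basis.det_apply]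
    exact Basis.isUnit_det _ _
  · have : ∀ j, (a ᵥ* (Pi.basisFun ℤ (Fin (n+1))).toMatrix B) j = ψ (B j) := by
      intro j
      rw [hψ]; rfl
    ext j
    rw [this]
    induction j using Fin.cases with
    | zero => rw [h0, hψ, h]; simp
    | succ j => rw [hs, LinearMap.mem_ker.mp (b' j).2]; simp

open Matrix in
theorem aux_det_congr {n : ℕ} (A X : Matrix (Fin n) (Fin n) ℤ) (d : Fin n → ℤ) (t : ℤ)
    (ht : ∀ i, t ∣ d i) : t ∣ (A + diagonal d * X).det - A.det := by
  rw [← Ideal.mem_span_singleton, ← Ideal.Quotient.mk_eq_mk_iff_sub_mem, RingHom.map_det,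
    RingHom.map_det]
  congr 1
  ext i j
  simp only [RingHom.mapMatrix_apply, Matrix.map_apply, Matrix.add_apply, map_add]
  rw [diagonal_mul, map_mul]
  have : Ideal.Quotient.mk (Ideal.span {t}) (d i) = 0 :=
    Ideal.Quotient.eq_zero_iff_mem.mpr (Ideal.mem_span_singleton.mpr (ht i))
  rw [this, zero_mul, add_zero]

theorem aux_det_row {n : ℕ} (A : Matrix (Fin (n+1)) (Fin (n+1)) ℤ) (h : A 0 = Pi.single 0 1) :
    A.det = (A.submatrix Fin.succ Fin.succ).det := by
  rw [Matrix.det_succ_row_zero, Fin.sum_univ_succ]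
  simp [h]

open Matrix in
theorem aux_main (n : ℕ) : ∀ (A : Matrix (Fin n) (Fin n) ℤ) (d : Fin n → ℤ)
    (_ : ∀ i j, i ≤ j → d j ∣ d i)
    (_ : ∀ v : Fin n → ℤ, ∃ x y : Fin n → ℤ, v = A *ᵥ x + diagonal d *ᵥ y)
    (ε : ℤ) (_ : IsUnit ε) (_ : ∀ t, (∀ i, t ∣ d i) → t ∣ A.det - ε),
    ∃ X : Matrix (Fin n) (Fin n) ℤ, IsUnit (A + diagonal d * X).det := by
  induction n with
  | zero =>
    intro A d _ _ ε _ _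
    exact ⟨0, by simp⟩
  | succ n ih =>
    intro A d hchain hsurj ε hε hdet
    rcases n with _ | n
    · obtain ⟨q, hq⟩ := hdet (d 0) (by intro i; fin_cases i; exact dvd_rfl)
      refine ⟨Matrix.of fun _ _ => -q, ?_⟩
      have e : ∀ B : Matrix (Fin (0+1)) (Fin (0+1)) ℤ, B.det = B 0 0 := fun B => det_fin_one B
      rw [e] at hq ⊢
      rw [Matrix.add_apply, diagonal_mul, of_apply]
      have : A 0 0 + d 0 * -q = ε := by linarith
      rw [this]; exact hε
    · obtain ⟨x, y, hxy⟩ := hsurj (Pi.single 0 1)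
      have h0 : A 0 ⬝ᵥ x + d 0 * y 0 = 1 := by
        have := congrFun hxy 0
        simp only [Pi.single_eq_same, Pi.add_apply, mulVec_diagonal] at this
        exact this.symm
      obtain ⟨w, x', hw⟩ := aux_modif (Pi.basisFun ℤ (Fin (n+2)))
        (dotProductBilin ℤ ℤ (A 0)) (d 0) x (y 0) h0
      let w' : Fin (n+2) → ℤ := fun i => w (Pi.single i 1)
      have hw' : ∀ v, w v = w' ⬝ᵥ v := by
        intro v
        rw [LinearMap.pi_apply_eq_sum_univ w v]
        simp only [dotProduct, smul_eq_mul, w']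
        refine Finset.sum_congr rfl fun i _ => ?_
        rw [mul_comm]
        congr 2
        ext j
        simp [Pi.single_apply, eq_comm]
      let X0 : Matrix (Fin (n+2)) (Fin (n+2)) ℤ := Matrix.of fun i => if i = 0 then w' else 0
      set A0 := A + diagonal d * X0 with hA0
      have hrow : A0 0 = A 0 + d 0 • w' := by
        ext j; simp [A0, X0, diagonal_mul]
      obtain ⟨V, hV, hVrow⟩ := aux_row (A0 0) x' (by
        rw [hrow, add_dotProduct, smul_dotProduct, ← hw']
        exact hw)
      have hVV : V * V⁻¹ = 1 := mul_nonsing_inv V hV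
      have hVV' : V⁻¹ * V = 1 := nonsing_inv_mul V hV
      set A1 := A0 * V with hA1
      have hA1row : A1 0 = Pi.single 0 1 := by
        rw [← hVrow]; ext j; rfl
      have hsurj1 : ∀ v : Fin (n+2) → ℤ, ∃ x y : Fin (n+2) → ℤ,
          v = A1 *ᵥ x + diagonal d *ᵥ y := by
        intro v
        obtain ⟨x, y, h⟩ := hsurj v
        refine ⟨V⁻¹ *ᵥ x, y - X0 *ᵥ x, ?_⟩
        rw [hA1, mulVec_mulVec, mul_assoc, hVV, mul_one, hA0, add_mulVec, mulVec_sub,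
          mulVec_mulVec, h]
        abel
      refine Exists.elim (ih (A1.submatrix Fin.succ Fin.succ) (fun i => d i.succ)
        (fun i j hij => hchain _ _ (Fin.succ_le_succ_iff.mpr hij)) ?_ (V.det * ε) (hV.mul hε) ?_) ?_
      rotate_left 2
      · intro X' hX'
        let X1 : Matrix (Fin (n+2)) (Fin (n+2)) ℤ :=
          Matrix.of (Fin.cons 0 (fun i => Fin.cons 0 (X' i)))
        refine ⟨X0 + X1 * V⁻¹, ?_⟩
        have e : A1 + diagonal d * X1 = (A + diagonal d * (X0 + X1 * V⁻¹)) * V := by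
          rw [hA1, hA0, mul_add, add_mul, add_mul, add_mul, mul_assoc (diagonal d) (X1 * V⁻¹) V,
            mul_assoc X1, hVV', mul_one]
          exact add_assoc _ _ _
        have hd : IsUnit (A1 + diagonal d * X1).det := by
          rw [aux_det_row]
          · convert hX' using 2
            ext i j
            simp [X1, diagonal_mul]
          · rw [← hA1row]
            ext j
            simp [X1, diagonal_mul]
        rw [e, det_mul] at hd
        exact isUnit_of_mul_isUnit_left hd
      · intro v
        obtain ⟨x, y, h⟩ := hsurj1 (Fin.cons 0 v)
        have h0 := congrFun h 0
        have hx0 : x 0 = - (d 0 * y 0) := by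
          simp only [Fin.cons_zero, Pi.add_apply, mulVec_diagonal] at h0
          have : (A1 *ᵥ x) 0 = x 0 := by
            change A1 0 ⬝ᵥ x = _
            rw [hA1row]; simp
          rw [this] at h0
          linarith
        choose q hq using fun i : Fin (n+1) => hchain 0 i.succ (Fin.zero_le _)
        refine ⟨fun i => x i.succ, fun i => y i.succ - A1 i.succ 0 * q i * y 0, ?_⟩
        ext i
        have hi := congrFun h i.succ
        simp only [Fin.cons_succ, Pi.add_apply, mulVec_diagonal] at hi
        simp only [mulVec, dotProduct] at hi
        rw [Fin.sum_univ_succ, hx0] at hi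
        simp only [Pi.add_apply, mulVec_diagonal]
        simp only [mulVec, dotProduct, submatrix_apply]
        rw [hi]
        linear_combination (- A1 i.succ 0 * y 0) * hq i
      · intro t ht
        have ht' : ∀ i, t ∣ d i := by
          intro i
          induction i using Fin.cases with
          | zero => exact (ht 0).trans (hchain _ _ (Fin.zero_le _))
          | succ i => exact ht i
        rw [← aux_det_row A1 hA1row, hA1, det_mul]
        have h1 := aux_det_congr A X0 d t ht'
        have h2 := hdet t ht'
        have : A0.det * V.det - V.det * ε = V.det * ((A0.det - A.det) + (A.det - ε)) := by ring
        rw [this]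
        exact (dvd_add h1 h2).mul_left _

open Matrix in
theorem aux_diag (r : ℕ) (H : Type) [AddCommGroup H]
    (π : (Fin r → ℤ) →+ H) (hπ : Function.Surjective π)
    (d : Fin r → ℤ) (hchain : ∀ i j, i ≤ j → d j ∣ d i)
    (hker : ∀ v, π v = 0 ↔ ∀ i, d i ∣ v i)
    (h : H ≃+ H) (ε : ℤ) (hε : IsUnit ε)
    (hdet : ∀ θ ∈ ⋀[ℤ]^r H,
      ExteriorAlgebra.map h.toAddMonoidHom.toIntLinearMap θ = ε • θ) :
    ∃ f : (Fin r → ℤ) ≃ₗ[ℤ] (Fin r → ℤ), ∀ v, π (f v) = h (π v) := by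
  choose c hc using fun j : Fin r => hπ (h (π (Pi.single j 1)))
  let G : Matrix (Fin r) (Fin r) ℤ := Matrix.of fun i j => c j i
  have hG : ∀ v, π (G *ᵥ v) = h (π v) := by
    have : π.toIntLinearMap ∘ₗ G.mulVecLin = h.toAddMonoidHom.toIntLinearMap ∘ₗ π.toIntLinearMap := by
      refine (Pi.basisFun ℤ (Fin r)).ext fun j => ?_
      simp only [LinearMap.comp_apply, mulVecLin_apply, Pi.basisFun_apply, mulVec_single_one]
      exact hc j
    intro v
    exact LinearMap.congr_fun this v
  refine Exists.elim (aux_main r G d hchain ?_ ε hε ?_) ?_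
  rotate_left 2
  · intro X hX
    refine ⟨Matrix.toLinearEquiv (Pi.basisFun ℤ (Fin r)) _ hX, fun v => ?_⟩
    have : Matrix.toLinearEquiv (Pi.basisFun ℤ (Fin r)) _ hX v = (G + diagonal d * X) *ᵥ v := by
      simp [Matrix.toLinearEquiv_apply, Matrix.toLin_eq_toLin', add_mulVec]
    rw [this, add_mulVec, map_add, hG, add_eq_left, hker]
    intro i
    rw [← mulVec_mulVec, mulVec_diagonal]
    exact dvd_mul_right _ _
  · intro v
    obtain ⟨x, hx⟩ := hπ (h.symm (π v))
    have : π (v - G *ᵥ x) = 0 := by rw [map_sub, hG, hx]; simp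
    rw [hker] at this
    choose y hy using this
    refine ⟨x, y, ?_⟩
    ext i
    rw [Pi.add_apply, mulVec_diagonal, ← hy]
    simp
  · intro t ht
    let R := ℤ ⧸ Ideal.span {t}
    let red : (Fin r → ℤ) →+ (Fin r → R) :=
      { toFun := fun v i => Ideal.Quotient.mk (Ideal.span {t}) (v i)
        map_zero' := by ext; simp
        map_add' := by intros; ext; simp }
    have hred : ∀ v i, red v i = Ideal.Quotient.mk (Ideal.span {t}) (v i) := fun _ _ => rfl
    have hle : π.ker ≤ red.ker := by
      intro v hv
      rw [AddMonoidHom.mem_ker] at hv ⊢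
      ext i
      rw [hred]
      exact Ideal.Quotient.eq_zero_iff_mem.mpr
        (Ideal.mem_span_singleton.mpr ((ht i).trans ((hker v).mp hv i)))
    let ρ : H →+ (Fin r → R) := π.liftOfSurjective hπ ⟨red, hle⟩
    have hρ : ∀ v, ρ (π v) = red v := fun v =>
      AddMonoidHom.liftOfRightInverse_comp_apply _ _ _ ⟨red, hle⟩ v
    let D : H [⋀^Fin r]→ₗ[ℤ] R :=
      AlternatingMap.compLinearMap
        { (detRowAlternating : (Fin r → R) [⋀^Fin r]→ₗ[R] R).toMultilinearMap.restrictScalars ℤ with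
          map_eq_zero_of_eq' :=
            (detRowAlternating : (Fin r → R) [⋀^Fin r]→ₗ[R] R).map_eq_zero_of_eq' }
        ρ.toIntLinearMap
    have hD : ∀ u : Fin r → H, D u = Matrix.det (Matrix.of fun i => ρ (u i)) := fun u => rfl
    let L : ExteriorAlgebra ℤ H →ₗ[ℤ] R :=
      ExteriorAlgebra.liftAlternating (fun i => if hi : r = i then hi ▸ D else 0)
    have hL : ∀ u : Fin r → H, L (ExteriorAlgebra.ιMulti ℤ r u) = D u := by
      intro u
      simp [L, ExteriorAlgebra.liftAlternating_apply_ιMulti]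
    have key := hdet (ExteriorAlgebra.ιMulti ℤ r fun j => π (Pi.single j 1))
      (ExteriorAlgebra.ιMulti_range ℤ r ⟨_, rfl⟩)
    rw [ExteriorAlgebra.map_apply_ιMulti] at key
    have key2 := congrArg L key
    rw [map_smul, hL, hL, hD, hD] at key2
    have e1 : (Matrix.of fun i => ρ (π (Pi.single i 1)) : Matrix (Fin r) (Fin r) R) = 1 := by
      ext i j
      simp [hρ, hred, Pi.single_apply, one_apply, eq_comm]
    have e2 : (Matrix.of fun i => ρ ((h.toAddMonoidHom.toIntLinearMap ∘ fun j => π (Pi.single j 1)) i)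
        : Matrix (Fin r) (Fin r) R) = ((Ideal.Quotient.mk (Ideal.span {t})).mapMatrix G)ᵀ := by
      ext i j
      have : (h.toAddMonoidHom.toIntLinearMap ∘ fun j => π (Pi.single j 1)) i = π (c i) := (hc i).symm
      rw [of_apply, this, hρ, hred]
      rfl
    rw [e1, e2, det_transpose, det_one, ← RingHom.map_det] at key2
    rw [← Ideal.mem_span_singleton, ← Ideal.Quotient.mk_eq_mk_iff_sub_mem, key2]
    simp


/-- Let `H` be a finite abelian group of rank `r` (so `r` is the minimal
cardinality of a generating set), let `π : F → H` be a surjection from the free abelian group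
`F = Fin r → ℤ` of rank exactly `r`, and let `h : H → H` be an automorphism whose induced map on
the `r`-th exterior power `⋀[ℤ]^r H` (a cyclic group of order the smallest elementary divisor
`τ`) is multiplication by `±1`.  Then `h` lifts to an automorphism `f` of `F`, i.e.
`π ∘ f = h ∘ π`. -/
theorem stmt_6 (r : ℕ) (H : Type) [AddCommGroup H] [Fintype H]
    (hmin : ∀ s : Finset H, Submodule.span ℤ (s : Set H) = ⊤ → r ≤ s.card)
    (π : (Fin r → ℤ) →+ H) (hπ : Function.Surjective π)
    (h : H ≃+ H)
    (hdet : (∀ θ ∈ ⋀[ℤ]^r H, ExteriorAlgebra.map h.toAddMonoidHom.toIntLinearMap θ = θ) ∨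
            (∀ θ ∈ ⋀[ℤ]^r H, ExteriorAlgebra.map h.toAddMonoidHom.toIntLinearMap θ = -θ)) :
    ∃ f : (Fin r → ℤ) ≃ₗ[ℤ] (Fin r → ℤ), ∀ v, π (f v) = h (π v) := by
  obtain ⟨b0, d0, hd0, hb0⟩ := aux_smith r (Fin r → ℤ) (Pi.basisFun ℤ (Fin r))
    (LinearMap.ker π.toIntLinearMap)
  let b := b0.reindex Fin.revPerm
  let e : (Fin r → ℤ) ≃ₗ[ℤ] (Fin r → ℤ) := b.equivFun
  have hex : ∃ ε : ℤ, IsUnit ε ∧ ∀ θ ∈ ⋀[ℤ]^r H,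
      ExteriorAlgebra.map h.toAddMonoidHom.toIntLinearMap θ = ε • θ := by
    rcases hdet with hd | hd
    · exact ⟨1, isUnit_one, fun θ hθ => by rw [hd θ hθ, one_smul]⟩
    · exact ⟨-1, isUnit_one.neg, fun θ hθ => by rw [hd θ hθ, neg_smul, one_smul]⟩
  obtain ⟨ε, hε, hd⟩ := hex
  obtain ⟨f, hf⟩ := aux_diag r H (π.comp e.symm.toLinearMap.toAddMonoidHom)
    (hπ.comp e.symm.surjective) (fun i => d0 i.rev)
    (fun i j hij => hd0 _ _ (Fin.rev_le_rev.mpr hij)) (by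
      intro v
      have h1 := hb0 (e.symm v)
      have h2 : ∀ i, b0.repr (e.symm v) i = v i.rev := by
        intro i
        have : e (e.symm v) i.rev = v i.rev := by rw [LinearEquiv.apply_symm_apply]
        rw [← this]
        simp [e, b, -LinearEquiv.apply_symm_apply]
      refine h1.trans ⟨fun h3 i => ?_, fun h3 i => ?_⟩
      · have := h3 i.rev
        rwa [h2, Fin.rev_rev] at this
      · have := h3 i.rev
        rwa [Fin.rev_rev, ← h2] at this) h ε hε hd
  refine ⟨(e.trans f).trans e.symm, fun v => ?_⟩
  have := hf (e v)
  simpa using this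
end
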